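/- Langmann–Szabo duality at the quadratic level of the action: for every real-valued φ ∈ 𝒮(ℝ^D, ℝ) and all real parameters m and Ω, ∫_{ℝ^D} ( ½ Σ_μ (∂_μ φ(x))² + (Ω²/2) x̃² φ(x)² + (m²/2) φ(x)² ) dx = ∫_{ℝ^D} ( ½ k̃² |φ̂(k)|² + (Ω²/2) Σ_μ |∂φ̂/∂k_μ (k)|² + (m²/2) |φ̂(k)|² ) dk, where ṽ² = Σ_μ ṽ_μ² = (4/θ²) |v|². In particular, the quadratic part of the Grosse–Wulkenhaar action with parameter Ω is mapped under the symplectic Fourier transform to the same quadratic form with the roles of the kinetic and harmonic terms exchanged. -/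

import Mathlib

open MeasureTheory

noncomputable section

/-- The standard symplectic matrix `Σ` on `ℝ^D`: block-diagonal with `D/2` blocks
`((0, -1), (1, 0))`. -/
def stdSigma (D : ℕ) : Matrix (Fin D) (Fin D) ℝ := fun i j =>
  if i.val % 2 = 1 ∧ i.val = j.val + 1 then 1
  else if j.val % 2 = 1 ∧ j.val = i.val + 1 then -1 else 0

/-- `Θ = θ Σ`. -/
def Theta (θ : ℝ) (D : ℕ) : Matrix (Fin D) (Fin D) ℝ := θ • stdSigma D

/-- `y ∧ z = 2 yᵀ Θ⁻¹ z`. -/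
def wedge (θ : ℝ) {D : ℕ} (y z : EuclideanSpace ℝ (Fin D)) : ℝ :=
  2 * ∑ i, ∑ j, y i * (Theta θ D)⁻¹ i j * z j

/-- The Moyal product `(f ⋆ g)(x) = (πθ)^{-D} ∬ f(x+y) g(x+z) e^{-i y∧z} dy dz`. -/
def moyal (θ : ℝ) {D : ℕ} (f g : EuclideanSpace ℝ (Fin D) → ℂ) :
    EuclideanSpace ℝ (Fin D) → ℂ := fun x =>
  ((Real.pi * θ) ^ D)⁻¹ •
    ∫ p : EuclideanSpace ℝ (Fin D) × EuclideanSpace ℝ (Fin D),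
      f (x + p.1) * g (x + p.2) * Complex.exp (-(Complex.I) * (wedge θ p.1 p.2 : ℂ))

/-- The symplectic Fourier transform
`φ̂(k) = (πθ)^{−D/2} ∫ φ(x) e^{−i k∧x} dx`. -/
def sympFourier (θ : ℝ) {D : ℕ} (φ : EuclideanSpace ℝ (Fin D) → ℂ) :
    EuclideanSpace ℝ (Fin D) → ℂ := fun k =>
  ((Real.pi * θ) ^ ((D : ℝ) / 2))⁻¹ •
    ∫ x : EuclideanSpace ℝ (Fin D), φ x * Complex.exp (-(Complex.I) * (wedge θ k x : ℂ))

/-- `ṽ_μ = 2 Θ⁻¹_{μν} v_ν`. -/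
def tilde (θ : ℝ) {D : ℕ} (v : EuclideanSpace ℝ (Fin D)) (μ : Fin D) : ℝ :=
  2 * ∑ ν, (Theta θ D)⁻¹ μ ν * v ν

open scoped FourierTransform SchwartzMap LineDeriv

/-- The index paired with `i` by a block of `stdSigma D`. -/
def sigmaPartner {D : ℕ} (hD : Even D) : Equiv.Perm (Fin D) :=
  Function.Involutive.toPerm
    (fun i => ⟨if i.val % 2 = 1 then i.val - 1 else i.val + 1, by
      have := i.isLt
      obtain ⟨r, rfl⟩ := hD
      split_ifs <;> omega⟩)
    (fun i => by
      ext
      dsimp only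
      split_ifs <;> omega)

/-- The nonzero entry of the row `i` of `stdSigma D`. -/
def sigmaSign {D : ℕ} (i : Fin D) : ℝ := if i.val % 2 = 1 then 1 else -1

lemma sigmaPartner_val {D : ℕ} (hD : Even D) (i : Fin D) :
    (sigmaPartner hD i).val = if i.val % 2 = 1 then i.val - 1 else i.val + 1 := rfl

lemma sigmaPartner_sigmaPartner {D : ℕ} (hD : Even D) (i : Fin D) :
    sigmaPartner hD (sigmaPartner hD i) = i := by
  ext
  simp only [sigmaPartner_val]
  split_ifs <;> omega

lemma sigmaSign_sigmaPartner {D : ℕ} (hD : Even D) (i : Fin D) :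
    sigmaSign (sigmaPartner hD i) = -sigmaSign i := by
  unfold sigmaSign
  rw [sigmaPartner_val]
  split_ifs <;> first | omega | simp

lemma sigmaSign_mul_self {D : ℕ} (i : Fin D) : sigmaSign i * sigmaSign i = 1 := by
  unfold sigmaSign
  split_ifs <;> simp

lemma stdSigma_apply {D : ℕ} (hD : Even D) (i j : Fin D) :
    stdSigma D i j = if j = sigmaPartner hD i then sigmaSign i else 0 := by
  unfold stdSigma sigmaSign
  simp only [Fin.ext_iff, sigmaPartner_val]
  split_ifs <;> first | omega | rfl

lemma stdSigma_mul_self {D : ℕ} (hD : Even D) : stdSigma D * stdSigma D = -1 := by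
  ext i j
  have h (l : Fin D) : stdSigma D i l * stdSigma D l j
      = if l = sigmaPartner hD i then sigmaSign i * stdSigma D l j else 0 := by
    rw [stdSigma_apply hD i l, ite_mul, zero_mul]
  rw [Matrix.mul_apply, Finset.sum_congr rfl fun l _ => h l, Finset.sum_ite_eq',
    if_pos (Finset.mem_univ _), stdSigma_apply hD, sigmaPartner_sigmaPartner,
    sigmaSign_sigmaPartner, Matrix.neg_apply, Matrix.one_apply, mul_ite, mul_neg,
    sigmaSign_mul_self, mul_zero]
  simp only [eq_comm (a := j)]
  split_ifs <;> simp

lemma Theta_inv {D : ℕ} (hD : Even D) {θ : ℝ} (hθ : θ ≠ 0) :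
    (Theta θ D)⁻¹ = -(θ⁻¹ • stdSigma D) := by
  apply Matrix.inv_eq_right_inv
  rw [Theta, Matrix.mul_neg, Matrix.smul_mul, Matrix.mul_smul, stdSigma_mul_self hD, smul_smul,
    mul_inv_cancel₀ hθ, one_smul, neg_neg]

lemma tilde_apply {D : ℕ} (hD : Even D) {θ : ℝ} (hθ : θ ≠ 0) (v : EuclideanSpace ℝ (Fin D))
    (μ : Fin D) : tilde θ v μ = -(2 / θ) * (sigmaSign μ * v (sigmaPartner hD μ)) := by
  simp only [tilde, Theta_inv hD hθ, Matrix.neg_apply, Matrix.smul_apply, stdSigma_apply hD,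
    smul_eq_mul, mul_ite, mul_zero, neg_mul, ite_mul, zero_mul, Finset.sum_neg_distrib,
    Finset.sum_ite_eq', Finset.mem_univ, if_true]
  ring

lemma wedge_eq_sum_mul_tilde {D : ℕ} (θ : ℝ) (y z : EuclideanSpace ℝ (Fin D)) :
    wedge θ y z = ∑ i, y i * tilde θ z i := by
  simp only [wedge, tilde, Finset.mul_sum]
  exact Finset.sum_congr rfl fun i _ => Finset.sum_congr rfl fun j _ => by ring

/-- The action of `stdSigma D` on `ℝ^D`, for `D` even, as a linear isometry. -/
def sigmaIsometry {D : ℕ} (hD : Even D) :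
    EuclideanSpace ℝ (Fin D) ≃ₗᵢ[ℝ] EuclideanSpace ℝ (Fin D) :=
  LinearIsometry.toLinearIsometryEquiv
    { toFun := fun v => WithLp.toLp 2 fun i => sigmaSign i * v (sigmaPartner hD i)
      map_add' := fun v w => by ext i; simp [mul_add]
      map_smul' := fun c v => by ext i; simp [mul_left_comm]
      norm_map' := fun v => by
        simp only [EuclideanSpace.norm_eq, LinearMap.coe_mk, AddHom.coe_mk, norm_mul, mul_pow]
        congr 1
        rw [← Equiv.sum_comp (sigmaPartner hD) fun i => ‖v i‖ ^ 2]
        refine Finset.sum_congr rfl fun i _ => ?_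
        rw [← norm_pow, pow_two, sigmaSign_mul_self, norm_one, one_mul] }
    rfl

lemma sigmaIsometry_apply {D : ℕ} (hD : Even D) (v : EuclideanSpace ℝ (Fin D)) (i : Fin D) :
    sigmaIsometry hD v i = sigmaSign i * v (sigmaPartner hD i) := rfl

lemma sigmaIsometry_single {D : ℕ} (hD : Even D) (μ : Fin D) :
    sigmaIsometry hD (EuclideanSpace.single μ 1)
      = -sigmaSign μ • EuclideanSpace.single (sigmaPartner hD μ) (1 : ℝ) := by
  ext i
  rw [sigmaIsometry_apply]
  have h : sigmaPartner hD i = μ ↔ i = sigmaPartner hD μ := by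
    constructor <;> rintro rfl <;> rw [sigmaPartner_sigmaPartner]
  by_cases hi : i = sigmaPartner hD μ
  · simp [hi, sigmaPartner_sigmaPartner, sigmaSign_sigmaPartner]
  · simp [hi, h]

lemma sum_tilde_sq {D : ℕ} (hD : Even D) {θ : ℝ} (hθ : θ ≠ 0) (v : EuclideanSpace ℝ (Fin D)) :
    ∑ μ, tilde θ v μ ^ 2 = (2 / θ) ^ 2 * ‖v‖ ^ 2 := by
  rw [← (sigmaIsometry hD).norm_map v, EuclideanSpace.real_norm_sq_eq, Finset.mul_sum]
  refine Finset.sum_congr rfl fun i _ => ?_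
  rw [tilde_apply hD hθ, sigmaIsometry_apply]
  ring

lemma wedge_eq_inner {D : ℕ} (hD : Even D) {θ : ℝ} (hθ : θ ≠ 0)
    (k x : EuclideanSpace ℝ (Fin D)) :
    wedge θ k x = 2 * Real.pi * inner ℝ x ((Real.pi * θ)⁻¹ • sigmaIsometry hD k) := by
  rw [wedge_eq_sum_mul_tilde, inner_smul_right, PiLp.inner_apply,
    ← Equiv.sum_comp (sigmaPartner hD), Finset.mul_sum, Finset.mul_sum]
  refine Finset.sum_congr rfl fun i _ => ?_
  rw [tilde_apply hD hθ, sigmaPartner_sigmaPartner, sigmaSign_sigmaPartner, sigmaIsometry_apply]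
  have := Real.pi_ne_zero
  simp only [RCLike.inner_apply, conj_trivial]
  field_simp

lemma sympFourier_eq_fourier {D : ℕ} (hD : Even D) {θ : ℝ} (hθ : θ ≠ 0)
    (f : EuclideanSpace ℝ (Fin D) → ℂ) (k : EuclideanSpace ℝ (Fin D)) :
    sympFourier θ f k
      = ((Real.pi * θ) ^ ((D : ℝ) / 2))⁻¹ • 𝓕 f ((Real.pi * θ)⁻¹ • sigmaIsometry hD k) := by
  rw [sympFourier, Real.fourier_eq']
  congr 2
  ext x
  rw [wedge_eq_inner hD hθ, smul_eq_mul, mul_comm]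
  congr 2
  push_cast
  ring

lemma integral_comp_inv_smul_sigmaIsometry {D : ℕ} (hD : Even D) {a : ℝ} (ha : 0 < a)
    (F : EuclideanSpace ℝ (Fin D) → ℝ) :
    ∫ k, F (a⁻¹ • sigmaIsometry hD k) = a ^ D * ∫ w, F w := by
  rw [(sigmaIsometry hD).measurePreserving.integral_comp
    (sigmaIsometry hD).toHomeomorph.measurableEmbedding fun w => F (a⁻¹ • w),
    Measure.integral_comp_inv_smul_of_nonneg _ _ ha.le, finrank_euclideanSpace_fin, smul_eq_mul]

section Schwartz

variable {V : Type*} [NormedAddCommGroup V] [InnerProductSpace ℝ V] [FiniteDimensional ℝ V]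
  [MeasurableSpace V] [BorelSpace V]

lemma SchwartzMap.integrable_norm_sq (f : 𝓢(V, ℂ)) : Integrable fun x => ‖f x‖ ^ 2 :=
  (f.memLp 2).integrable_norm_pow two_ne_zero

lemma SchwartzMap.integrable_sum_norm_sq {ι : Type*} [Fintype ι] (f : ι → 𝓢(V, ℂ)) :
    Integrable fun x => ∑ i, ‖f i x‖ ^ 2 :=
  integrable_finsetSum _ fun i _ => (f i).integrable_norm_sq

lemma SchwartzMap.integral_sum_norm_sq_fourier {ι : Type*} [Fintype ι] (f : ι → 𝓢(V, ℂ)) :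
    ∫ w, ∑ i, ‖𝓕 (f i) w‖ ^ 2 = ∫ x, ∑ i, ‖f i x‖ ^ 2 := by
  rw [integral_finsetSum _ fun i _ => (𝓕 (f i)).integrable_norm_sq,
    integral_finsetSum _ fun i _ => (f i).integrable_norm_sq]
  exact Finset.sum_congr rfl fun i _ => (f i).integral_norm_sq_fourier

end Schwartz

lemma norm_fourier_lineDerivOp_single_sq {D : ℕ} (ψ : 𝓢(EuclideanSpace ℝ (Fin D), ℂ))
    (μ : Fin D) (w : EuclideanSpace ℝ (Fin D)) :
    ‖𝓕 (∂_{EuclideanSpace.single μ (1 : ℝ)} ψ) w‖ ^ 2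
      = (2 * Real.pi) ^ 2 * (w μ ^ 2 * ‖𝓕 ψ w‖ ^ 2) := by
  have h : Function.HasTemperateGrowth
      fun x : EuclideanSpace ℝ (Fin D) => inner ℝ x (EuclideanSpace.single μ (1 : ℝ)) := by fun_prop
  rw [SchwartzMap.fourier_lineDerivOp_eq, smul_apply,
    SchwartzMap.smulLeftCLM_apply_apply h]
  simp [EuclideanSpace.inner_single_right, mul_pow, abs_of_pos Real.pi_pos]

/-- Plancherel's theorem for the quadratic form of a harmonic oscillator. -/
lemma integral_oscillator_fourier {D : ℕ} (ψ : 𝓢(EuclideanSpace ℝ (Fin D), ℂ)) (A B C : ℝ) :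
    ∫ x, (A * ∑ μ, ‖fderiv ℝ ψ x (EuclideanSpace.single μ 1)‖ ^ 2
        + B * ((2 * Real.pi) ^ 2 * (‖x‖ ^ 2 * ‖ψ x‖ ^ 2)) + C * ‖ψ x‖ ^ 2)
      = ∫ w, (A * ((2 * Real.pi) ^ 2 * (‖w‖ ^ 2 * ‖𝓕 ψ w‖ ^ 2))
        + B * ∑ μ, ‖fderiv ℝ (𝓕 ψ : 𝓢(EuclideanSpace ℝ (Fin D), ℂ)) w
          (EuclideanSpace.single μ 1)‖ ^ 2
        + C * ‖𝓕 ψ w‖ ^ 2) := by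
  have h (μ : Fin D) : Function.HasTemperateGrowth
      fun x : EuclideanSpace ℝ (Fin D) => inner ℝ x (EuclideanSpace.single μ (1 : ℝ)) := by fun_prop
  let d (μ : Fin D) : 𝓢(EuclideanSpace ℝ (Fin D), ℂ) := ∂_{EuclideanSpace.single μ (1 : ℝ)} ψ
  let q (μ : Fin D) : 𝓢(EuclideanSpace ℝ (Fin D), ℂ) := -(2 * Real.pi * Complex.I) •
    SchwartzMap.smulLeftCLM ℂ (inner ℝ · (EuclideanSpace.single μ (1 : ℝ))) ψ
  have hd (x) : ∑ μ, ‖fderiv ℝ ψ x (EuclideanSpace.single μ 1)‖ ^ 2 = ∑ μ, ‖d μ x‖ ^ 2 := rfl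
  have hq (x) : (2 * Real.pi) ^ 2 * (‖x‖ ^ 2 * ‖ψ x‖ ^ 2) = ∑ μ, ‖q μ x‖ ^ 2 := by
    rw [EuclideanSpace.real_norm_sq_eq, Finset.sum_mul, Finset.mul_sum]
    refine Finset.sum_congr rfl fun μ _ => ?_
    rw [smul_apply, SchwartzMap.smulLeftCLM_apply_apply (h μ)]
    simp [EuclideanSpace.inner_single_right, mul_pow, abs_of_pos Real.pi_pos]
  have hFd (w) : (2 * Real.pi) ^ 2 * (‖w‖ ^ 2 * ‖𝓕 ψ w‖ ^ 2) = ∑ μ, ‖𝓕 (d μ) w‖ ^ 2 := by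
    rw [EuclideanSpace.real_norm_sq_eq, Finset.sum_mul, Finset.mul_sum]
    exact Finset.sum_congr rfl fun μ _ => (norm_fourier_lineDerivOp_single_sq ψ μ w).symm
  have hFq (w) : ∑ μ, ‖fderiv ℝ (𝓕 ψ : 𝓢(EuclideanSpace ℝ (Fin D), ℂ)) w
      (EuclideanSpace.single μ 1)‖ ^ 2
      = ∑ μ, ‖𝓕 (q μ) w‖ ^ 2 := by
    refine Finset.sum_congr rfl fun μ _ => ?_
    rw [← SchwartzMap.lineDerivOp_fourier_eq, SchwartzMap.lineDerivOp_apply_eq_fderiv]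
  simp only [hd, hq, hFd, hFq]
  have hI (f g : Fin D → 𝓢(EuclideanSpace ℝ (Fin D), ℂ))
      (r : 𝓢(EuclideanSpace ℝ (Fin D), ℂ)) :
      ∫ x, (A * ∑ μ, ‖f μ x‖ ^ 2 + B * ∑ μ, ‖g μ x‖ ^ 2 + C * ‖r x‖ ^ 2)
        = A * (∫ x, ∑ μ, ‖f μ x‖ ^ 2) + B * (∫ x, ∑ μ, ‖g μ x‖ ^ 2) + C * ∫ x, ‖r x‖ ^ 2 := by
    have hf := (SchwartzMap.integrable_sum_norm_sq f).const_mul A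
    have hg := (SchwartzMap.integrable_sum_norm_sq g).const_mul B
    rw [integral_add (by exact hf.add hg) (r.integrable_norm_sq.const_mul C), integral_add hf hg,
      integral_const_mul, integral_const_mul, integral_const_mul]
  rw [hI d q ψ, hI (fun μ => 𝓕 (d μ)) (fun μ => 𝓕 (q μ)) (𝓕 ψ),
    SchwartzMap.integral_sum_norm_sq_fourier, SchwartzMap.integral_sum_norm_sq_fourier,
    SchwartzMap.integral_norm_sq_fourier]

lemma sum_norm_fderiv_comp_sigmaIsometry_sq {D : ℕ} (hD : Even D)
    {g : EuclideanSpace ℝ (Fin D) → ℂ} (hg : Differentiable ℝ g) (b c : ℝ)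
    (k : EuclideanSpace ℝ (Fin D)) :
    ∑ μ, ‖fderiv ℝ (fun k => c • g (b • sigmaIsometry hD k)) k (EuclideanSpace.single μ 1)‖ ^ 2
      = c ^ 2 * b ^ 2 *
        ∑ μ, ‖fderiv ℝ g (b • sigmaIsometry hD k) (EuclideanSpace.single μ 1)‖ ^ 2 := by
  have hL : HasFDerivAt (fun k => b • sigmaIsometry hD k)
      (b • (sigmaIsometry hD : EuclideanSpace ℝ (Fin D) →L[ℝ] EuclideanSpace ℝ (Fin D))) k :=
    ((sigmaIsometry hD).toContinuousLinearEquiv.hasFDerivAt).const_smul b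
  have hF := ((hg (b • sigmaIsometry hD k)).hasFDerivAt.comp k hL).const_smul c
  rw [← Equiv.sum_comp (sigmaPartner hD) fun μ =>
    ‖fderiv ℝ g (b • sigmaIsometry hD k) (EuclideanSpace.single μ 1)‖ ^ 2, Finset.mul_sum]
  refine Finset.sum_congr rfl fun μ _ => ?_
  have hs : |sigmaSign μ| ^ 2 = 1 := by rw [sq_abs, pow_two, sigmaSign_mul_self]
  have he : fderiv ℝ (fun k => c • g (b • sigmaIsometry hD k)) k (EuclideanSpace.single μ 1)
      = c • b • -sigmaSign μ • fderiv ℝ g (b • sigmaIsometry hD k)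
        (EuclideanSpace.single (sigmaPartner hD μ) 1) := by
    rw [HasFDerivAt.fderiv (f := fun k => c • g (b • sigmaIsometry hD k)) hF]
    change c • fderiv ℝ g _ (b • sigmaIsometry hD (EuclideanSpace.single μ 1)) = _
    rw [sigmaIsometry_single, map_smul, map_smul]
  rw [he]
  simp only [norm_smul, norm_neg, Real.norm_eq_abs, mul_pow, hs, sq_abs]
  ring

/-- Langmann–Szabo duality at the quadratic level of the action. For a
real-valued Schwartz field `φ`, the quadratic part
`∫ (½ Σ_μ (∂_μφ)² + (Ω²/2) x̃² φ² + (m²/2) φ²) dx` equals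
`∫ (½ k̃² |φ̂|² + (Ω²/2) Σ_μ |∂_μφ̂|² + (m²/2) |φ̂|²) dk`. -/
theorem langmann_szabo_quadratic (D : ℕ) (hD : 0 < D) (hDeven : Even D)
    (θ : ℝ) (hθ : 0 < θ) (m Ω : ℝ)
    (φ : SchwartzMap (EuclideanSpace ℝ (Fin D)) ℝ) :
    (∫ x : EuclideanSpace ℝ (Fin D),
      ((1 : ℝ) / 2) * ∑ μ, (fderiv ℝ (⇑φ) x (EuclideanSpace.single μ (1 : ℝ))) ^ 2
        + (Ω ^ 2 / 2) * (∑ μ, (tilde θ x μ) ^ 2) * (φ x) ^ 2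
        + (m ^ 2 / 2) * (φ x) ^ 2)
    = ∫ k : EuclideanSpace ℝ (Fin D),
      ((1 : ℝ) / 2) * (∑ μ, (tilde θ k μ) ^ 2)
          * ‖sympFourier θ (fun x => ((φ x : ℝ) : ℂ)) k‖ ^ 2
        + (Ω ^ 2 / 2) * ∑ μ, ‖fderiv ℝ (sympFourier θ (fun x => ((φ x : ℝ) : ℂ))) k
            (EuclideanSpace.single μ (1 : ℝ))‖ ^ 2
        + (m ^ 2 / 2) * ‖sympFourier θ (fun x => ((φ x : ℝ) : ℂ)) k‖ ^ 2 := by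
  have ha : 0 < Real.pi * θ := by positivity
  set a := Real.pi * θ with ha_def
  let ψ : 𝓢(EuclideanSpace ℝ (Fin D), ℂ) := φ.postcompCLM Complex.ofRealCLM
  have hψ (x) : ψ x = (φ x : ℂ) := rfl
  have hψ_coe : (fun x => ((φ x : ℝ) : ℂ)) = ψ := rfl
  have hψ_norm (x) : ‖ψ x‖ ^ 2 = φ x ^ 2 := by
    rw [hψ, Complex.norm_real, Real.norm_eq_abs, sq_abs]
  have hψ_deriv (x v) : ‖fderiv ℝ ψ x v‖ ^ 2 = fderiv ℝ φ x v ^ 2 := by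
    have : HasFDerivAt ψ (Complex.ofRealCLM.comp (fderiv ℝ φ x)) x :=
      Complex.ofRealCLM.hasFDerivAt.comp x φ.differentiableAt.hasFDerivAt
    rw [this.fderiv, ContinuousLinearMap.comp_apply, Complex.ofRealCLM_apply, Complex.norm_real,
      Real.norm_eq_abs, sq_abs]
  have hsymp : sympFourier θ ψ
      = fun k => (a ^ ((D : ℝ) / 2))⁻¹ • 𝓕 ψ (a⁻¹ • sigmaIsometry hDeven k) :=
    funext (sympFourier_eq_fourier hDeven hθ.ne' ψ)
  have hc : ((a ^ ((D : ℝ) / 2))⁻¹) ^ 2 = (a ^ D)⁻¹ := by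
    rw [inv_pow, ← Real.rpow_natCast, ← Real.rpow_mul ha.le]
    norm_num
  have hl := integral_oscillator_fourier ψ (1 / 2) (Ω ^ 2 / 2 * (a⁻¹) ^ 2) (m ^ 2 / 2)
  rw [hψ_coe, hsymp]
  simp only [sum_tilde_sq hDeven hθ.ne',
    sum_norm_fderiv_comp_sigmaIsometry_sq hDeven (𝓕 ψ).differentiable]
  trans ∫ x, (1 / 2 * ∑ μ, ‖fderiv ℝ ψ x (EuclideanSpace.single μ 1)‖ ^ 2
        + Ω ^ 2 / 2 * (a⁻¹) ^ 2 * ((2 * Real.pi) ^ 2 * (‖x‖ ^ 2 * ‖ψ x‖ ^ 2))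
        + m ^ 2 / 2 * ‖ψ x‖ ^ 2)
  · congr 1
    ext x
    simp only [hψ_deriv, hψ_norm, ha_def]
    field_simp
  rw [hl, ← mul_right_inj' (pow_pos ha D).ne',
    ← integral_comp_inv_smul_sigmaIsometry hDeven ha, ← integral_const_mul]
  congr 1
  ext k
  simp only [norm_smul, (sigmaIsometry hDeven).norm_map, mul_pow, hc, norm_inv,
    Real.norm_eq_abs, abs_of_pos ha, abs_of_pos (Real.rpow_pos_of_pos ha _)]
  simp only [ha_def]
  field_simp
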